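/- Let D be a subset of a metric space, let h₁, h₂, … be maps from cl(D) into D each of which is a contraction of rate β < 1, and let B ⊆ D be an open set with B ⊆ ⋃_{i=1}^∞ h_i(B). Then for every x ∈ B there is a sequence (i_j)_{j≥1} of indices such that x = lim_{n→∞} h_{i₁} ∘ … ∘ h_{i_n}(y) for every y ∈ B. -/

import Mathlib

open Set Function Filter

/-- `compWord h idx n = h (idx 0) ∘ h (idx 1) ∘ ⋯ ∘ h (idx (n-1))`,
i.e. the composition `h_{i₁} ∘ ⋯ ∘ h_{i_n}` where `i_j = idx (j-1)`. -/
def compWord {X : Type*} (h : ℕ → X → X) (idx : ℕ → ℕ) : ℕ → X → X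
  | 0 => id
  | n + 1 => compWord h idx n ∘ h (idx n)

open Topology

theorem dist_compWord_le {X : Type*} [PseudoMetricSpace X] {C : Set X} {h : ℕ → X → X} {γ : ℝ}
    (hγ : 0 ≤ γ) (hmap : ∀ i, MapsTo (h i) C C)
    (hcontr : ∀ i, ∀ x ∈ C, ∀ y ∈ C, dist (h i x) (h i y) ≤ γ * dist x y)
    (idx : ℕ → ℕ) (n : ℕ) {x y : X} (hx : x ∈ C) (hy : y ∈ C) :
    dist (compWord h idx n x) (compWord h idx n y) ≤ γ ^ n * dist x y := by
  induction n generalizing x y with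
  | zero => simp [compWord]
  | succ n ih =>
    calc dist (compWord h idx n (h (idx n) x)) (compWord h idx n (h (idx n) y))
        ≤ γ ^ n * dist (h (idx n) x) (h (idx n) y) := ih (hmap _ hx) (hmap _ hy)
      _ ≤ γ ^ n * (γ * dist x y) := by gcongr; exact hcontr _ _ hx _ hy
      _ = γ ^ (n + 1) * dist x y := by ring

theorem exists_compWord_eq {X : Type*} {B : Set X} {h : ℕ → X → X}
    (hcover : B ⊆ ⋃ i, h i '' B) {x : X} (hx : x ∈ B) :
    ∃ idx : ℕ → ℕ, ∀ n, ∃ z ∈ B, compWord h idx n z = x := by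
  have hpre (b : B) : ∃ (i : ℕ) (z : B), h i z = b := by
    obtain ⟨i, z, hz, hzb⟩ := mem_iUnion.1 (hcover b.2)
    exact ⟨i, ⟨z, hz⟩, hzb⟩
  choose f g hfg using hpre
  refine ⟨fun n => f (g^[n] ⟨x, hx⟩), fun n => ⟨g^[n] ⟨x, hx⟩, Subtype.coe_prop _, ?_⟩⟩
  induction n with
  | zero => rfl
  | succ n ih => rwa [compWord, comp_apply, iterate_succ_apply', hfg]

/-- If `h₁, h₂, …` map `cl(D)` into `D` as contractions of rate `β < 1` and `B ⊆ D` is an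
open bounded set with `B ⊆ ⋃ᵢ hᵢ(B)`, then for every `x ∈ B` there is a sequence of indices
`(i_j)` such that `x = lim_n h_{i₁} ∘ ⋯ ∘ h_{i_n}(y)` for every `y ∈ B`. -/
theorem statement8 {X : Type*} [MetricSpace X] (D B : Set X) (h : ℕ → X → X)
    (β : ℝ) (hβ : β < 1)
    (hmap : ∀ i, Set.MapsTo (h i) (closure D) D)
    (hcontr : ∀ i, ∀ x ∈ closure D, ∀ y ∈ closure D, dist (h i x) (h i y) ≤ β * dist x y)
    (hBopen : IsOpen B) (hBD : B ⊆ D) (hBbdd : Bornology.IsBounded B)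
    (hcover : B ⊆ ⋃ i, h i '' B) :
    ∀ x ∈ B, ∃ idx : ℕ → ℕ, ∀ y ∈ B,
      Filter.Tendsto (fun n => compWord h idx n y) Filter.atTop (nhds x) := by
  intro x hx
  obtain ⟨idx, hidx⟩ := exists_compWord_eq hcover hx
  refine ⟨idx, fun y hy => ?_⟩
  have hBC : B ⊆ closure D := hBD.trans subset_closure
  have hlim : Tendsto (fun n => max β 0 ^ n * Metric.diam B) atTop (𝓝 0) := by
    simpa using (tendsto_pow_atTop_nhds_zero_of_lt_one (le_max_right β 0)
      (max_lt hβ one_pos)).mul_const (Metric.diam B)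
  refine tendsto_iff_dist_tendsto_zero.2 (squeeze_zero (fun _ => dist_nonneg) (fun n => ?_) hlim)
  obtain ⟨z, hz, hzx⟩ := hidx n
  calc dist (compWord h idx n y) x
      = dist (compWord h idx n y) (compWord h idx n z) := by rw [hzx]
    _ ≤ max β 0 ^ n * dist y z :=
      dist_compWord_le (le_max_right β 0) (fun i => (hmap i).mono_right subset_closure)
        (fun i a ha b hb => (hcontr i a ha b hb).trans (by gcongr; exact le_max_left β 0))
        idx n (hBC hy) (hBC hz)
    _ ≤ max β 0 ^ n * Metric.diam B := by
      gcongr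
      exact Metric.dist_le_diam_of_mem hBbdd hy hz
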